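/- There exist a live weakly-hierarchical visibly pushdown automaton A and two reachability-aware quotienting (RAQ) relations R1 and R2 for A such that the smallest equivalence relation E containing R1 ∪ R2 is not a RAQ relation for A, and moreover L(A/E) ≠ L(A). In other words, for VPA, mergeability of states is not transitive: two language-preserving merges cannot in general be combined. -/

import Mathlib

/-- The kind of a symbol in a visibly pushdown alphabet:
internal, call, or return. -/
inductive SymKind : Type
  | int | call | ret
deriving DecidableEq

/-- A weakly-hierarchical visibly pushdown automaton over states `Q` and
alphabet `S`.  The partition of the alphabet is given by `kind`; the
bottom-of-stack symbol is implicit (stacks are lists of states, the empty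
list playing the role of `⊥`, and the head of the list being the topmost
symbol). -/
structure VPA (Q : Type) (S : Type) where
  kind : S → SymKind
  δi : Q → S → Q → Prop
  δc : Q → S → Q → Prop
  δr : Q → S → Q → Q → Prop
  Q0 : Set Q
  F : Set Q
  Q0_nonempty : Q0.Nonempty
  δi_kind : ∀ p a q, δi p a q → kind a = SymKind.int
  δc_kind : ∀ p c q, δc p c q → kind c = SymKind.call
  δr_kind : ∀ p r qh q, δr p r qh q → kind r = SymKind.ret

namespace VPA

variable {Q S : Type}

/-- A configuration: current state together with the stack
(head = topmost symbol; `[]` = the empty stack `⊥`). -/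
abbrev Config (Q : Type) := Q × List Q

/-- One step of the automaton on a symbol. Internal symbols leave the stack
unchanged, call symbols push the current state, return symbols pop the
matching topmost stack symbol. -/
def Step (A : VPA Q S) (c : Config Q) (s : S) (c' : Config Q) : Prop :=
  match A.kind s with
  | SymKind.int  => A.δi c.1 s c'.1 ∧ c'.2 = c.2
  | SymKind.call => A.δc c.1 s c'.1 ∧ c'.2 = c.1 :: c.2
  | SymKind.ret  => ∃ qh, A.δr c.1 s qh c'.1 ∧ c.2 = qh :: c'.2

/-- `ρ` is a run of `A` on the word `w`. -/
def IsRunOn (A : VPA Q S) (w : List S) (ρ : Fin (w.length + 1) → Config Q) : Prop :=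
  ∀ i : Fin w.length, A.Step (ρ i.castSucc) (w.get i) (ρ i.succ)

/-- A run is initial if it starts in an initial state with the empty stack `⊥`. -/
def IsInitial (A : VPA Q S) {n : ℕ} (ρ : Fin (n + 1) → Config Q) : Prop :=
  (ρ 0).1 ∈ A.Q0 ∧ (ρ 0).2 = []

/-- `A` accepts `w` if some initial run of `A` on `w` ends in an accepting state. -/
def Accepts (A : VPA Q S) (w : List S) : Prop :=
  ∃ ρ : Fin (w.length + 1) → Config Q,
    A.IsRunOn w ρ ∧ A.IsInitial ρ ∧ (ρ (Fin.last w.length)).1 ∈ A.F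

/-- The language of `A`. -/
def lang (A : VPA Q S) : Set (List S) := {w | A.Accepts w}

/-- A configuration is reachable if it occurs in some initial run of `A`. -/
def Reachable (A : VPA Q S) (c : Config Q) : Prop :=
  ∃ (w : List S) (ρ : Fin (w.length + 1) → Config Q),
    A.IsRunOn w ρ ∧ A.IsInitial ρ ∧ ∃ i, ρ i = c

/-- `tops A q` = set of topmost stack symbols of reachable stacks for `q`
(`none` plays the role of the bottom-of-stack symbol `⊥`). -/
def tops (A : VPA Q S) (q : Q) : Set (Option Q) :=
  {t | ∃ σ : List Q, A.Reachable (q, σ) ∧ σ.head? = t}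

/-- `A` is live: every state has outgoing transitions for every internal and
call symbol, and has an outgoing return transition for return symbol `s` and
stack symbol `qh` if and only if `qh` is the topmost symbol of some
reachable stack. -/
def Live (A : VPA Q S) : Prop :=
  (∀ q s, A.kind s = SymKind.int → ∃ q', A.δi q s q') ∧
  (∀ q s, A.kind s = SymKind.call → ∃ q', A.δc q s q') ∧
  (∀ q s qh, A.kind s = SymKind.ret →
    ((∃ q', A.δr q s qh q') ↔ some qh ∈ A.tops q))

/-- `R` is a reachability-aware quotienting (RAQ) relation for `A`. -/
def IsRAQ (A : VPA Q S) (R : Q → Q → Prop) : Prop :=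
  Equivalence R ∧
  ∀ p q, R p q →
    (p ∈ A.F ↔ q ∈ A.F) ∧
    (∀ a p', A.δi p a p' → ∃ q', A.δi q a q' ∧ R p' q') ∧
    (∀ a q', A.δi q a q' → ∃ p', A.δi p a p' ∧ R p' q') ∧
    (∀ c p', A.δc p c p' → ∃ q', A.δc q c q' ∧ R p' q') ∧
    (∀ c q', A.δc q c q' → ∃ p', A.δc p c p' ∧ R p' q') ∧
    (∀ ph qh, R ph qh →
      ((∀ r p', A.δr p r ph p' → ∃ q', A.δr q r qh q' ∧ R p' q') ∧
       (∀ r q', A.δr q r qh q' → ∃ p', A.δr p r ph p' ∧ R p' q'))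
      ∨ some qh ∉ A.tops q ∨ some ph ∉ A.tops p)

/-- The quotient VPA `A/R` for an equivalence relation (setoid) `R` on states. -/
def quot (A : VPA Q S) (R : Setoid Q) : VPA (Quotient R) S where
  kind := A.kind
  δi := fun P a P' => ∃ p p', A.δi p a p' ∧
    Quotient.mk R p = P ∧ Quotient.mk R p' = P'
  δc := fun P c P' => ∃ p p', A.δc p c p' ∧
    Quotient.mk R p = P ∧ Quotient.mk R p' = P'
  δr := fun P r Ph P' => ∃ p ph p', A.δr p r ph p' ∧
    Quotient.mk R p = P ∧ Quotient.mk R ph = Ph ∧ Quotient.mk R p' = P'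
  Q0 := {P | ∃ q ∈ A.Q0, Quotient.mk R q = P}
  F := {P | ∃ q ∈ A.F, Quotient.mk R q = P}
  Q0_nonempty := by
    obtain ⟨q, hq⟩ := A.Q0_nonempty
    exact ⟨Quotient.mk R q, q, hq, rfl⟩
  δi_kind := by rintro P a P' ⟨p, p', h, -, -⟩; exact A.δi_kind p a p' h
  δc_kind := by rintro P c P' ⟨p, p', h, -, -⟩; exact A.δc_kind p c p' h
  δr_kind := by rintro P r Ph P' ⟨p, ph, p', h, -, -, -⟩; exact A.δr_kind p r ph p' h

end VPA

/-- A word is matched-return if every prefix ending in a return symbol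
has strictly more call symbols than return symbols before that return. -/
def MR {S : Type} (kind : S → SymKind) (w : List S) : Prop :=
  ∀ v r, (v ++ [r]) <+: w → kind r = SymKind.ret →
    v.countP (fun s => decide (kind s = SymKind.call)) >
      v.countP (fun s => decide (kind s = SymKind.ret))

namespace VPA

/-- Every reachable configuration satisfies a property that holds initially and is preserved by
steps. -/
theorem Reachable.of_invariant {Q S : Type} {A : VPA Q S} {P : Config Q → Prop}
    (init : ∀ q ∈ A.Q0, P (q, [])) (step : ∀ c s c', P c → A.Step c s c' → P c')
    {c : Config Q} (hc : A.Reachable c) : P c := by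
  obtain ⟨w, ρ, hrun, ⟨hq, hσ⟩, i, rfl⟩ := hc
  induction i using Fin.induction with
  | zero =>
    have h := init _ hq
    rwa [← hσ] at h
  | succ i ih => exact step _ _ _ ih (hrun i)

end VPA

namespace MergeCounterexample

/-- States of the counterexample. The states `left` and `right` differ only in what they do when
they return to `start`, whereas `idle` never returns to `start`. -/
inductive State : Type
  | start | left | right | acc | idle
deriving DecidableEq

instance : Fintype State :=
  ⟨{.start, .left, .right, .acc, .idle}, fun q => by cases q <;> decide⟩

/-- The alphabet: two call symbols and one return symbol. -/
inductive Letter : Type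
  | callL | callR | ret
deriving DecidableEq

instance : Fintype Letter :=
  ⟨{.callL, .callR, .ret}, fun s => by cases s <;> decide⟩

open State Letter

def symKind : Letter → SymKind
  | callL => SymKind.call
  | callR => SymKind.call
  | ret => SymKind.ret

def callNext : State → Letter → Option State
  | _, ret => none
  | start, callL => some left
  | start, callR => some right
  | _, _ => some idle

/-- The return successor, given the current state and the topmost stack symbol. -/
def retNext : State → State → Option State
  | left, start => some acc
  | right, start => some idle
  | idle, left => some left
  | idle, right => some right
  | idle, acc => some idle
  | idle, idle => some idle
  | _, _ => none

def aut : VPA State Letter where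
  kind := symKind
  δi _ _ _ := False
  δc p c q := callNext p c = some q
  δr p r h q := r = ret ∧ retNext p h = some q
  Q0 := {start}
  F := {acc}
  Q0_nonempty := ⟨start, rfl⟩
  δi_kind _ _ _ h := h.elim
  δc_kind := by decide
  δr_kind := by rintro _ _ _ _ ⟨rfl, -⟩; rfl

/-- Stacks that can occur under the state `idle`. -/
inductive IdleStack : List State → Prop
  | nil : IdleStack []
  | acc : IdleStack [acc]
  | left : IdleStack [left, start]
  | right : IdleStack [right, start]
  | idle {σ : List State} : IdleStack σ → IdleStack (idle :: σ)

def ValidConfig : VPA.Config State → Prop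
  | (start, σ) => σ = []
  | (acc, σ) => σ = []
  | (left, σ) => σ = [start]
  | (right, σ) => σ = [start]
  | (idle, σ) => IdleStack σ

theorem validConfig_step (c : VPA.Config State) (s : Letter) (c' : VPA.Config State)
    (hc : ValidConfig c) (h : aut.Step c s c') : ValidConfig c' := by
  obtain ⟨q, σ⟩ := c
  obtain ⟨q', σ'⟩ := c'
  cases s
  case ret =>
    obtain ⟨t, ⟨-, ht⟩, hσ⟩ := h
    change σ = t :: σ' at hσ
    subst hσ
    cases q <;> cases t <;> simp [retNext] at ht <;> subst ht <;>
      simp_all [ValidConfig] <;> cases hc <;> first | rfl | constructor | assumption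
  all_goals
    obtain ⟨hq, hσ⟩ := h
    change σ' = q :: σ at hσ
    subst hσ
    cases q <;> simp [aut, callNext] at hq <;> subst hq <;>
      simp_all [ValidConfig] <;> constructor <;> assumption

theorem validConfig_of_reachable {c : VPA.Config State} (hc : aut.Reachable c) :
    ValidConfig c :=
  hc.of_invariant (by rintro _ rfl; rfl) validConfig_step

theorem some_mem_tops_of_run {q t : State} {σ : List State} (w : List Letter)
    (ρ : Fin (w.length + 1) → VPA.Config State) (hrun : aut.IsRunOn w ρ)
    (hinit : ρ 0 = (start, [])) (hlast : ρ (Fin.last _) = (q, t :: σ)) :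
    some t ∈ aut.tops q :=
  ⟨t :: σ, ⟨w, ρ, hrun, by simp [VPA.IsInitial, hinit, aut], _, hlast⟩, rfl⟩

theorem some_mem_tops_iff (q t : State) :
    some t ∈ aut.tops q ↔ retNext q t ≠ none := by
  constructor
  · rintro ⟨σ, hσ, ht⟩
    have hv := validConfig_of_reachable hσ
    cases q <;> simp only [ValidConfig] at hv
    case idle => cases hv <;> simp at ht <;> subst ht <;> simp [retNext]
    all_goals subst hv; simp at ht; try (subst ht; simp [retNext])
  · intro h
    cases q <;> cases t <;> simp [retNext] at h
    case left.start =>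
      refine some_mem_tops_of_run [callL] ![(start, []), (left, [start])] ?_ rfl rfl
      intro i; fin_cases i; simp [VPA.Step, aut, symKind, callNext]
    case right.start =>
      refine some_mem_tops_of_run [callR] ![(start, []), (right, [start])] ?_ rfl rfl
      intro i; fin_cases i; simp [VPA.Step, aut, symKind, callNext]
    case idle.left =>
      refine some_mem_tops_of_run [callL, callL]
        ![(start, []), (left, [start]), (idle, [left, start])] ?_ rfl rfl
      intro i; fin_cases i <;> simp [VPA.Step, aut, symKind, callNext]
    case idle.right =>
      refine some_mem_tops_of_run [callR, callL]
        ![(start, []), (right, [start]), (idle, [right, start])] ?_ rfl rfl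
      intro i; fin_cases i <;> simp [VPA.Step, aut, symKind, callNext]
    case idle.acc =>
      refine some_mem_tops_of_run [callL, ret, callL]
        ![(start, []), (left, [start]), (acc, []), (idle, [acc])] ?_ rfl rfl
      intro i; fin_cases i <;> simp [VPA.Step, aut, symKind, callNext, retNext]
    case idle.idle =>
      refine some_mem_tops_of_run [callL, callL, callL]
        ![(start, []), (left, [start]), (idle, [left, start]), (idle, [idle, left, start])]
        ?_ rfl rfl
      intro i; fin_cases i <;> simp [VPA.Step, aut, symKind, callNext]

theorem aut_live : aut.Live := by
  refine ⟨fun q s h => ?_, fun q s h => ?_, fun q s t h => ?_⟩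
  · cases s <;> simp [aut, symKind] at h
  · cases s <;> cases q <;> simp [aut, symKind, callNext] at h ⊢
  · rw [some_mem_tops_iff, Option.ne_none_iff_exists']
    cases s <;> simp [aut, symKind] at h ⊢

/-- The map identifying `m` with `idle`. -/
def collapse (m q : State) : State := if q = m then idle else q

/-- The equivalence relation merging `m` with `idle`. -/
def Merge (m p q : State) : Prop := collapse m p = collapse m q

instance (m p q : State) : Decidable (Merge m p q) :=
  inferInstanceAs (Decidable (_ = _))

theorem merge_equivalence (m : State) : Equivalence (Merge m) :=
  ⟨fun _ => rfl, Eq.symm, Eq.trans⟩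

theorem retNext_merge {m : State} (hm : m = left ∨ m = right) :
    ∀ p q, Merge m p q → ∀ t u, Merge m t u → ∀ p' q',
      retNext p t = some p' → retNext q u = some q' → Merge m p' q' := by
  rcases hm with rfl | rfl <;> decide

theorem callNext_merge {m : State} (hm : m = left ∨ m = right) :
    ∀ p q, Merge m p q → ∀ c p', callNext p c = some p' →
      ∃ q', callNext q c = some q' ∧ Merge m p' q' := by
  rcases hm with rfl | rfl <;> decide

theorem merge_isRAQ {m : State} (hm : m = left ∨ m = right) : aut.IsRAQ (Merge m) := by
  refine ⟨merge_equivalence m, fun p q hpq => ⟨?_, fun _ _ h => h.elim, fun _ _ h => h.elim,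
    callNext_merge hm p q hpq, fun c q' h => ?_, fun t u htu => ?_⟩⟩
  · change p = acc ↔ q = acc
    revert p q
    rcases hm with rfl | rfl <;> decide
  · obtain ⟨p', hp', hr⟩ := callNext_merge hm q p hpq.symm c q' h
    exact ⟨p', hp', hr.symm⟩
  · rw [some_mem_tops_iff, some_mem_tops_iff, not_ne_iff, not_ne_iff]
    rcases hq : retNext q u with _ | q'
    · exact .inr (.inl rfl)
    rcases hp : retNext p t with _ | p'
    · exact .inr (.inr rfl)
    have hr := retNext_merge hm p q hpq t u htu p' q' hp hq
    refine .inl ⟨?_, ?_⟩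
    · rintro r _ ⟨rfl, h⟩
      obtain rfl := Option.some.inj (hp.symm.trans h)
      exact ⟨q', ⟨rfl, hq⟩, hr⟩
    · rintro r _ ⟨rfl, h⟩
      obtain rfl := Option.some.inj (hq.symm.trans h)
      exact ⟨p', ⟨rfl, hp⟩, hr⟩

/-- The smallest equivalence relation containing both merges. -/
abbrev Join : State → State → Prop :=
  Relation.EqvGen (fun p q => Merge left p q ∨ Merge right p q)

theorem join_left_right : Join left right :=
  .trans _ idle _ (.rel _ _ (.inl rfl)) (.rel _ _ (.inr rfl))

theorem Join.acc_iff {p q : State} (h : Join p q) : p = acc ↔ q = acc := by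
  induction h with
  | rel p q h =>
    revert p q
    decide
  | refl => rfl
  | symm _ _ _ ih => exact ih.symm
  | trans _ _ _ _ _ ih₁ ih₂ => exact ih₁.trans ih₂

theorem join_not_isRAQ : ¬ aut.IsRAQ Join := by
  rintro ⟨-, h⟩
  obtain ⟨-, -, -, -, -, h⟩ := h left right join_left_right
  rcases h start start (.refl _) with ⟨h, -⟩ | h | h
  · obtain ⟨q', ⟨-, hq'⟩, hj⟩ := h ret acc ⟨rfl, rfl⟩
    obtain rfl := Option.some.inj hq'
    simpa using hj.acc_iff
  · exact h ((some_mem_tops_iff _ _).2 (by decide))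
  · exact h ((some_mem_tops_iff _ _).2 (by decide))

theorem callR_ret_not_mem_lang : [callR, ret] ∉ aut.lang := by
  rintro ⟨ρ, hrun, ⟨hq, hσ⟩, hF⟩
  obtain ⟨h₁, hσ₁⟩ : callNext (ρ 0).1 callR = some (ρ 1).1 ∧ (ρ 1).2 = (ρ 0).1 :: (ρ 0).2 :=
    hrun 0
  obtain ⟨t, ⟨-, h₂⟩, hσ₂⟩ : ∃ t, (ret = ret ∧ retNext (ρ 1).1 t = some (ρ 2).1) ∧
      (ρ 1).2 = t :: (ρ 2).2 := hrun 1
  change (ρ 0).1 = start at hq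
  change (ρ 2).1 = acc at hF
  rw [hq] at h₁ hσ₁
  obtain rfl : start = t := (List.cons.inj (hσ₁.symm.trans hσ₂)).1
  rw [← Option.some.inj h₁, hF] at h₂
  simp [retNext] at h₂

theorem callR_ret_mem_quot_lang :
    [callR, ret] ∈ (aut.quot (Relation.EqvGen.setoid
      (fun p q => Merge left p q ∨ Merge right p q))).lang := by
  refine ⟨![(Quotient.mk _ start, []), (Quotient.mk _ right, [Quotient.mk _ start]),
    (Quotient.mk _ acc, [])], fun i => ?_, ⟨⟨start, rfl, rfl⟩, rfl⟩, ⟨acc, rfl, rfl⟩⟩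
  fin_cases i
  · exact ⟨⟨start, right, rfl, rfl, rfl⟩, rfl⟩
  · exact ⟨Quotient.mk _ start,
      ⟨left, start, acc, ⟨rfl, rfl⟩, Quotient.sound join_left_right, rfl, rfl⟩, rfl⟩

end MergeCounterexample

/-- **Mergeability is not transitive for VPA.**  There are a live VPA and two
RAQ relations for it whose join (the smallest equivalence relation containing
their union) is not a RAQ relation and changes the language under
quotienting. -/
theorem raq_not_transitive :
    ∃ (Q : Type) (_ : Fintype Q) (S : Type) (_ : Fintype S) (A : VPA Q S),
      A.Live ∧
      ∃ R1 R2 : Q → Q → Prop, A.IsRAQ R1 ∧ A.IsRAQ R2 ∧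
        ¬A.IsRAQ (Relation.EqvGen (fun p q => R1 p q ∨ R2 p q)) ∧
        (A.quot (Relation.EqvGen.setoid (fun p q => R1 p q ∨ R2 p q))).lang
          ≠ A.lang := by
  open MergeCounterexample in
  exact ⟨State, inferInstance, Letter, inferInstance, aut, aut_live, Merge .left, Merge .right,
    merge_isRAQ (.inl rfl), merge_isRAQ (.inr rfl), join_not_isRAQ,
    fun h => callR_ret_not_mem_lang (h ▸ callR_ret_mem_quot_lang)⟩
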